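/- Let d ≥ 3 be an integer and let 0 < α < π. Then ∫₀^α ((1 + cos α)/(1 + cos η))^{(d−1)/2} · ((1 + cos α)/(cos η − cos α))^{1/2} · ₂F₁(1, (d−1)/2; 1/2; (cos η − cos α)/(1 + cos η)) · sin^{d−2}(η) dη = (√π · 2^{d−2} · Γ((d−1)/2) / Γ(d/2 − 1)) · B(sin²(α/2); (d−2)/2, d/2). -/

import Mathlib

open Real MeasureTheory

/-- The Pochhammer symbol `(a)_n = a(a+1)⋯(a+n−1)`, with `(a)_0 = 1`. -/
noncomputable def poch (a : ℝ) (n : ℕ) : ℝ := ∏ i ∈ Finset.range n, (a + i)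

/-- The Gauss hypergeometric function `₂F₁(a,b;c;z) = Σₙ ((a)ₙ(b)ₙ/(c)ₙ) zⁿ/n!`. -/
noncomputable def hyp2F1 (a b c z : ℝ) : ℝ :=
  ∑' n : ℕ, poch a n * poch b n / poch c n * z ^ n / (n.factorial : ℝ)

/-- The incomplete Beta function `B(z; a, b) = ∫₀^z t^{a−1}(1−t)^{b−1} dt`. -/
noncomputable def incBeta (z a b : ℝ) : ℝ := ∫ t in (0:ℝ)..z, t ^ (a - 1) * (1 - t) ^ (b - 1)

open Filter Topology Set

theorem poch_succ (a : ℝ) (n : ℕ) : poch a (n + 1) = poch a n * (a + n) :=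
  Finset.prod_range_succ _ _

theorem poch_pos {a : ℝ} (ha : 0 < a) (n : ℕ) : 0 < poch a n :=
  Finset.prod_pos fun i _ => by positivity

theorem poch_one (n : ℕ) : poch 1 n = n.factorial := by
  induction n with
  | zero => simp [poch]
  | succ k ih => rw [poch_succ, ih, Nat.factorial_succ]; push_cast; ring

theorem hyp2F1_one (p z : ℝ) :
    hyp2F1 1 p (1 / 2) z = ∑' n : ℕ, poch p n / poch (1 / 2) n * z ^ n := by
  unfold hyp2F1
  refine tsum_congr fun n => ?_
  have := (poch_pos (a := 1 / 2) (by norm_num) n).ne'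
  have : (n.factorial : ℝ) ≠ 0 := by positivity
  rw [poch_one]
  field_simp

theorem poch_ratio_succ (p : ℝ) (n : ℕ) :
    poch p (n + 1) / poch (1 / 2) (n + 1) * (n + 1 / 2) =
      (p + n) * (poch p n / poch (1 / 2) n) := by
  have := (poch_pos (a := 1 / 2) (by norm_num) n).ne'
  rw [poch_succ, poch_succ]
  field_simp
  ring

theorem summable_natCast_mul_poch_ratio {p : ℝ} (hp : 0 < p) {r : ℝ} (h0 : 0 < r) (h1 : r < 1) :
    Summable fun n : ℕ => n * (poch p n / poch (1 / 2) n) * r ^ n := by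
  have hlim : Tendsto (fun n : ℕ => (1 + 1 / (n : ℝ)) * ((p + n) / (1 / 2 + n)) * r)
      atTop (𝓝 r) := by
    have h2 : Tendsto (fun n : ℕ => (p + (n : ℝ)) / (1 / 2 + n)) atTop (𝓝 1) := by
      have h := tendsto_add_mul_div_add_mul_atTop_nhds p (1 / 2 : ℝ) 1 (d := 1) one_ne_zero
      simpa using h
    have := ((tendsto_const_nhds (x := (1 : ℝ))).add
      tendsto_one_div_atTop_nhds_zero_nat).mul h2 |>.mul_const r
    simpa using this
  refine summable_of_ratio_test_tendsto_lt_one h1 ?_ (hlim.congr' ?_)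
  · filter_upwards [eventually_gt_atTop 0] with n hn
    have := (poch_pos (a := 1 / 2) (by norm_num) n).ne'
    have := (poch_pos hp n).ne'
    positivity
  · filter_upwards [eventually_gt_atTop 0] with n hn
    have hq := poch_pos (a := 1 / 2) (by norm_num)
    have hq0 := hq n
    have hq1 := hq (n + 1)
    have hp0 := poch_pos hp n
    have hp1 := poch_pos hp (n + 1)
    rw [Real.norm_of_nonneg (by positivity),
      Real.norm_of_nonneg (by positivity), poch_succ, poch_succ, pow_succ]
    push_cast
    field_simp

/-- The first-order equation satisfied by `₂F₁(1, p; 1/2; ·)`. -/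
theorem hasDerivAt_hyp2F1_one {p : ℝ} (hp : 0 < p) {z : ℝ} (hz : |z| < 1) :
    ∃ F' : ℝ, HasDerivAt (hyp2F1 1 p (1 / 2)) F' z ∧
      z * (1 - z) * F' = (1 / 2 + p * z) * hyp2F1 1 p (1 / 2) z - 1 / 2 := by
  obtain ⟨r, hzr, hr1⟩ := exists_between hz
  have hr0 : 0 < r := (abs_nonneg z).trans_lt hzr
  have hu := summable_natCast_mul_poch_ratio hp hr0 hr1
  have hpos : ∀ n, 0 < poch p n / poch (1 / 2) n := fun n =>
    div_pos (poch_pos hp n) (poch_pos (by norm_num) n)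
  set u : ℕ → ℝ := fun n => poch p n / poch (1 / 2) n with hudef
  have hsum : ∀ y : ℝ, |y| < r → Summable fun n : ℕ => u n * y ^ n := by
    intro y hy
    rw [← summable_nat_add_iff 1]
    refine Summable.of_norm_bounded ((summable_nat_add_iff 1).2 hu) fun n => ?_
    rw [norm_mul, norm_pow, Real.norm_of_nonneg (hpos _).le, Real.norm_eq_abs]
    have h1 : u (n + 1) ≤ ((n + 1 : ℕ) : ℝ) * u (n + 1) :=
      le_mul_of_one_le_left (hpos _).le (by push_cast; linarith [n.cast_nonneg (α := ℝ)])
    have := (hpos (n + 1)).le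
    gcongr
  have hsum' : Summable fun n : ℕ => (n : ℝ) * u n * z ^ n := by
    refine Summable.of_norm_bounded hu fun n => ?_
    have := (hpos n).le
    rw [norm_mul, norm_pow, Real.norm_of_nonneg (by positivity), Real.norm_eq_abs]
    gcongr
  have hder : HasDerivAt (fun y => ∑' n : ℕ, u n * y ^ n)
      (∑' n : ℕ, u n * (n * z ^ (n - 1))) z := by
    have hbound : ∀ (n : ℕ) (y : ℝ), y ∈ Metric.ball (0 : ℝ) r →
        ‖u n * (n * y ^ (n - 1))‖ ≤ n * u n * r ^ n / r := by
      intro n y hy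
      rcases n with _ | n
      · simp
      rw [mem_ball_zero_iff, Real.norm_eq_abs] at hy
      have := (hpos (n + 1)).le
      rw [norm_mul, norm_mul, norm_pow, Real.norm_of_nonneg this, Real.norm_natCast,
        Real.norm_eq_abs, Nat.add_sub_cancel, pow_succ, mul_div_assoc,
        mul_div_cancel_right₀ _ hr0.ne', mul_left_comm, mul_assoc]
      gcongr
    exact hasDerivAt_tsum_of_isPreconnected (hu.div_const r) Metric.isOpen_ball
      (convex_ball _ _).isPreconnected (fun n y _ => (hasDerivAt_pow n y).const_mul (u n))
      hbound (Metric.mem_ball_self hr0) (hsum 0 (by simpa using hr0))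
      (by rwa [mem_ball_zero_iff, Real.norm_eq_abs])
  have hF : hyp2F1 1 p (1 / 2) = fun y => ∑' n : ℕ, u n * y ^ n := funext fun y => hyp2F1_one p y
  refine ⟨_, hF ▸ hder, ?_⟩
  rw [hF]
  beta_reduce
  have hs := hsum z hzr
  have hθ : z * (∑' n : ℕ, u n * (n * z ^ (n - 1))) = ∑' n : ℕ, (n : ℝ) * u n * z ^ n := by
    rw [← tsum_mul_left]
    refine tsum_congr fun n => ?_
    rcases n with _ | n
    · simp
    · rw [Nat.add_sub_cancel, pow_succ]; ring
  have hrec : (∑' n : ℕ, (n : ℝ) * u n * z ^ n) - 1 / 2 * ∑' n : ℕ, u n * z ^ n =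
      -(1 / 2) + z * ((∑' n : ℕ, (n : ℝ) * u n * z ^ n) + p * ∑' n : ℕ, u n * z ^ n) := by
    rw [← tsum_mul_left (a := p), ← hsum'.tsum_add (hs.mul_left p), ← tsum_mul_left (a := z),
      ← tsum_mul_left (a := 1 / 2), ← hsum'.tsum_sub (hs.mul_left _),
      (hsum'.sub (hs.mul_left _)).tsum_eq_zero_add]
    congr 1
    · simp [hudef, poch]
    · refine tsum_congr fun n => ?_
      have := poch_ratio_succ p n
      simp only [hudef]
      push_cast
      linear_combination z ^ (n + 1) * this
  rw [← hθ] at hrec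
  linear_combination hrec

theorem integral_rpow_mul_sub_rpow {a b s : ℝ} (ha : 0 < a) (hb : 0 < b) (hs : 0 < s) :
    ∫ x in (0 : ℝ)..s, x ^ (a - 1) * (s - x) ^ (b - 1) =
      s ^ (a + b - 1) * ProbabilityTheory.beta a b := by
  have h := Complex.betaIntegral_scaled a b hs
  have hB : Complex.betaIntegral a b = (ProbabilityTheory.beta a b : ℝ) := by
    rw [Complex.betaIntegral_eq_Gamma_mul_div _ _ (by simpa) (by simpa), ProbabilityTheory.beta,
      ← Complex.ofReal_add, Complex.Gamma_ofReal, Complex.Gamma_ofReal, Complex.Gamma_ofReal]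
    norm_cast
  rw [hB] at h
  apply Complex.ofReal_injective
  rw [← intervalIntegral.integral_ofReal, Complex.ofReal_mul, Complex.ofReal_cpow hs.le]
  push_cast
  rw [← h]
  refine intervalIntegral.integral_congr fun x hx => ?_
  rw [uIcc_of_le hs.le] at hx
  rw [Complex.ofReal_cpow hx.1, Complex.ofReal_cpow (sub_nonneg.2 hx.2)]
  push_cast
  rfl

theorem hyp2F1_one_zero (p : ℝ) : hyp2F1 1 p (1 / 2) 0 = 1 := by
  rw [hyp2F1_one, tsum_eq_single 0 fun n hn => by simp [hn]]
  simp [poch]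

theorem intervalIntegrable_rpow_mul_one_sub_rpow {a : ℝ} (ha : -1 < a) (b : ℝ) {z : ℝ}
    (hz0 : 0 < z) (hz1 : z < 1) :
    IntervalIntegrable (fun t : ℝ => t ^ a * (1 - t) ^ b) volume 0 z := by
  refine (intervalIntegral.intervalIntegrable_rpow' ha).mul_continuousOn ?_
  rw [uIcc_of_le hz0.le]
  exact (continuousOn_const.sub continuousOn_id).rpow_const fun t ht =>
    Or.inl (sub_pos.2 (ht.2.trans_lt hz1)).ne'

theorem hyp2F1_one_eq_integral {p z : ℝ} (hp : 0 < p) (hz0 : 0 < z) (hz1 : z < 1) :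
    z ^ (-1 / 2 : ℝ) * (1 - z) ^ (p + 1 / 2) * hyp2F1 1 p (1 / 2) z =
      z ^ (-1 / 2 : ℝ) * (1 - z) ^ (p - 1 / 2) +
        (p - 1 / 2) * ∫ t in (0 : ℝ)..z, t ^ (-1 / 2 : ℝ) * (1 - t) ^ (p - 3 / 2) := by
  set R : ℝ → ℝ := fun t =>
    t ^ (-1 / 2 : ℝ) * (1 - t) ^ (p - 1 / 2) * ((1 - t) * hyp2F1 1 p (1 / 2) t - 1) with hR
  have hRd : ∀ t : ℝ, 0 < t → t < 1 →
      HasDerivAt R ((p - 1 / 2) * (t ^ (-1 / 2 : ℝ) * (1 - t) ^ (p - 3 / 2))) t := by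
    intro t ht0 ht1
    obtain ⟨F', hF, hode⟩ := hasDerivAt_hyp2F1_one hp (abs_lt.2 ⟨by linarith, ht1⟩)
    have h1t : 0 < 1 - t := by linarith
    have hsub : HasDerivAt (fun t : ℝ => 1 - t) (-1) t := by
      simpa using (hasDerivAt_id t).const_sub 1
    have hd := ((hasDerivAt_rpow_const (p := (-1 / 2 : ℝ)) (Or.inl ht0.ne')).mul
      (hsub.rpow_const (p := p - 1 / 2) (Or.inl h1t.ne'))).mul ((hsub.mul hF).sub_const 1)
    refine hd.congr_deriv ?_
    have e1 : t ^ (-1 / 2 : ℝ) = t * t ^ (-1 / 2 - 1 : ℝ) := by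
      rw [rpow_sub_one ht0.ne']; field_simp
    have e2 : (1 - t) ^ (p - 1 / 2) = (1 - t) * (1 - t) ^ (p - 1 / 2 - 1) := by
      rw [rpow_sub_one h1t.ne']; field_simp
    simp only [Pi.mul_apply]
    rw [e2, e1, show p - 3 / 2 = p - 1 / 2 - 1 by ring]
    linear_combination t ^ (-1 / 2 - 1 : ℝ) * (1 - t) ^ (p - 1 / 2 - 1) * (1 - t) * hode
  have hR0 : Tendsto R (𝓝[>] 0) (𝓝 0) := by
    obtain ⟨F', hF, -⟩ := hasDerivAt_hyp2F1_one hp (z := 0) (by simp)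
    have hG := (((hasDerivAt_id (0 : ℝ)).const_sub 1).mul hF).sub_const 1
    have hslope := hG.tendsto_slope.mono_left (nhdsGT_le_nhdsNE 0)
    have hc : ContinuousAt (fun t : ℝ => t ^ (1 / 2 : ℝ) * (1 - t) ^ (p - 1 / 2)) 0 :=
      (continuousAt_id.rpow_const (Or.inr (by norm_num))).mul
        ((continuousAt_const.sub continuousAt_id).rpow_const (Or.inl (by simp)))
    have := (hc.tendsto.mono_left nhdsWithin_le_nhds).mul hslope
    rw [zero_rpow (by norm_num), zero_mul, zero_mul] at this
    refine this.congr' ?_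
    filter_upwards [self_mem_nhdsWithin] with t (ht : 0 < t)
    have e : t ^ (1 / 2 : ℝ) = t ^ (-1 / 2 : ℝ) * t := by
      rw [← rpow_add_one ht.ne']; norm_num
    simp only [hR, slope_def_field, e, Pi.mul_apply, hyp2F1_one_zero, id, sub_zero]
    field_simp
    ring
  have hint := (intervalIntegrable_rpow_mul_one_sub_rpow (a := -1 / 2) (by norm_num) (p - 3 / 2)
    hz0 hz1).const_mul (p - 1 / 2)
  have hFTC := intervalIntegral.integral_eq_sub_of_hasDerivAt_of_tendsto hz0
    (fun t ht => hRd t ht.1 (ht.2.trans hz1)) hint hR0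
    ((hRd z hz0 hz1).continuousAt.tendsto.mono_left nhdsWithin_le_nhds)
  rw [intervalIntegral.integral_const_mul] at hFTC
  rw [hFTC, hR, show p + 1 / 2 = (p - 1 / 2) + 1 by ring, rpow_add_one (by linarith)]
  ring

theorem integral_rpow_comp_affine {a u S : ℝ} (b : ℝ) (huS : u ≤ S) (hS : S < 1) :
    ∫ t in (0 : ℝ)..(S - u) / (1 - u), t ^ a * (1 - t) ^ b =
      (1 - u) ^ (-a - b - 1) * ∫ s in u..S, (s - u) ^ a * (1 - s) ^ b := by
  have hu : 0 < 1 - u := by linarith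
  have h := intervalIntegral.integral_comp_div_sub (a := u) (b := S)
    (fun t : ℝ => t ^ a * (1 - t) ^ b) hu.ne' (u / (1 - u))
  rw [← sub_div, ← sub_div, sub_self, zero_div, smul_eq_mul] at h
  have h' : ∫ s in u..S, (s / (1 - u) - u / (1 - u)) ^ a * (1 - (s / (1 - u) - u / (1 - u))) ^ b =
      (1 - u) ^ (-a - b) * ∫ s in u..S, (s - u) ^ a * (1 - s) ^ b := by
    rw [← intervalIntegral.integral_const_mul]
    refine intervalIntegral.integral_congr fun s hs => ?_
    rw [uIcc_of_le huS] at hs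
    have e : 1 - (s / (1 - u) - u / (1 - u)) = (1 - s) / (1 - u) := by field_simp; ring
    rw [e, ← sub_div, div_rpow (by linarith [hs.1]) hu.le, div_rpow (by linarith [hs.2]) hu.le,
      rpow_sub hu, rpow_neg hu.le]
    field_simp
  rw [h'] at h
  rw [rpow_sub_one hu.ne', div_mul_eq_mul_div, h]
  field_simp

theorem intervalIntegrable_rpow_mul_sub_rpow {a b s : ℝ} (ha : 0 < a) (hb : 0 < b) (hs : 0 < s) :
    IntervalIntegrable (fun x : ℝ => x ^ (a - 1) * (s - x) ^ (b - 1)) volume 0 s := by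
  refine intervalIntegral.intervalIntegrable_of_integral_ne_zero ?_
  rw [integral_rpow_mul_sub_rpow ha hb hs]
  have := ProbabilityTheory.beta_pos ha hb
  positivity

/-- Fubini on the triangle `0 < u < s ≤ S` for the Abel kernel `(s - u) ^ (b - 1)`. -/
theorem integral_rpow_mul_integral_sub_rpow {a b S : ℝ} (ha : 0 < a) (hb : 0 < b) (hS : 0 < S)
    {g : ℝ → ℝ} (hg : Measurable g) (hgc : ContinuousOn g (Icc 0 S))
    (hg0 : ∀ s ∈ Icc 0 S, 0 ≤ g s) :
    IntervalIntegrable (fun u => u ^ (a - 1) * ∫ s in u..S, (s - u) ^ (b - 1) * g s) volume 0 S ∧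
      ∫ u in (0 : ℝ)..S, u ^ (a - 1) * ∫ s in u..S, (s - u) ^ (b - 1) * g s =
        ProbabilityTheory.beta a b * ∫ s in (0 : ℝ)..S, s ^ (a + b - 1) * g s := by
  set k : ℝ × ℝ → ℝ := {q : ℝ × ℝ | q.1 < q.2}.indicator
    fun q => q.1 ^ (a - 1) * (q.2 - q.1) ^ (b - 1) * g q.2 with hk
  have hkm : Measurable k :=
    Measurable.indicator (by fun_prop) (measurableSet_lt measurable_fst measurable_snd)
  have hku : ∀ s, (fun u => k (u, s)) =
      (Iio s).indicator fun u => u ^ (a - 1) * (s - u) ^ (b - 1) * g s := fun s => by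
    ext u; simp [hk, indicator]
  have hks : ∀ u, (fun s => k (u, s)) =
      (Ioi u).indicator fun s => u ^ (a - 1) * (s - u) ^ (b - 1) * g s := fun u => by
    ext s; simp [hk, indicator]
  have hIoo : ∀ s ∈ Ioc 0 S, Ioc 0 S ∩ Iio s = Ioo 0 s := fun s hs => by
    ext u; simp only [mem_inter_iff, mem_Ioc, mem_Iio, mem_Ioo]
    exact ⟨fun h => ⟨h.1.1, h.2⟩, fun h => ⟨⟨h.1, h.2.le.trans hs.2⟩, h.2⟩⟩
  have hIoc : ∀ u ∈ Ioc 0 S, Ioc 0 S ∩ Ioi u = Ioc u S := fun u hu => by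
    ext s; simp only [mem_inter_iff, mem_Ioc, mem_Ioi]
    exact ⟨fun h => ⟨h.2, h.1.2⟩, fun h => ⟨⟨hu.1.trans h.1, h.2⟩, h.1⟩⟩
  have hinner : ∀ s ∈ Ioc 0 S, ∫ u in Ioc 0 S, k (u, s) =
      ProbabilityTheory.beta a b * (s ^ (a + b - 1) * g s) := fun s hs => by
    rw [hku, setIntegral_indicator measurableSet_Iio, hIoo s hs, integral_mul_const,
      ← integral_Ioc_eq_integral_Ioo, ← intervalIntegral.integral_of_le hs.1.le,
      integral_rpow_mul_sub_rpow ha hb hs.1]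
    ring
  have hinner' : ∀ u ∈ Ioc 0 S, ∫ s in Ioc 0 S, k (u, s) =
      u ^ (a - 1) * ∫ s in u..S, (s - u) ^ (b - 1) * g s := fun u hu => by
    rw [hks, setIntegral_indicator measurableSet_Ioi, hIoc u hu,
      ← intervalIntegral.integral_of_le hu.2, ← intervalIntegral.integral_const_mul]
    simp only [mul_assoc]
  have hk0 : ∀ u ∈ Ioc 0 S, ∀ s ∈ Ioc 0 S, 0 ≤ k (u, s) := fun u hu s hs => by
    refine indicator_apply_nonneg fun hq => ?_
    have h1 : 0 ≤ s - u := sub_nonneg.2 (le_of_lt hq)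
    have h2 := hg0 s (Ioc_subset_Icc_self hs)
    have h3 := hu.1.le
    positivity
  have hint : Integrable k ((volume.restrict (Ioc 0 S)).prod (volume.restrict (Ioc 0 S))) := by
    rw [integrable_prod_iff' hkm.aestronglyMeasurable]
    constructor
    · filter_upwards [ae_restrict_mem measurableSet_Ioc] with s hs
      rw [hku, integrable_indicator_iff measurableSet_Iio, IntegrableOn,
        Measure.restrict_restrict measurableSet_Iio, inter_comm, hIoo s hs, ← IntegrableOn,
        ← integrableOn_Ioc_iff_integrableOn_Ioo]
      exact ((intervalIntegrable_iff_integrableOn_Ioc_of_le hs.1.le).1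
        (intervalIntegrable_rpow_mul_sub_rpow ha hb hs.1)).mul_const _
    · have h1 : IntegrableOn (fun s => ProbabilityTheory.beta a b * (s ^ (a + b - 1) * g s))
          (Ioc 0 S) := by
        rw [← intervalIntegrable_iff_integrableOn_Ioc_of_le hS.le]
        refine (IntervalIntegrable.mul_continuousOn
          (intervalIntegral.intervalIntegrable_rpow' (by linarith)) ?_).const_mul _
        rwa [uIcc_of_le hS.le]
      refine h1.congr ?_
      filter_upwards [ae_restrict_mem measurableSet_Ioc] with s hs
      rw [← hinner s hs]
      refine setIntegral_congr_fun measurableSet_Ioc fun u hu => ?_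
      exact (Real.norm_of_nonneg (hk0 u hu s hs)).symm
  constructor
  · rw [intervalIntegrable_iff_integrableOn_Ioc_of_le hS.le]
    refine hint.integral_prod_left.congr ?_
    filter_upwards [ae_restrict_mem measurableSet_Ioc] with u hu using hinner' u hu
  · rw [intervalIntegral.integral_of_le hS.le, intervalIntegral.integral_of_le hS.le,
      ← integral_const_mul, ← setIntegral_congr_fun measurableSet_Ioc hinner,
      ← setIntegral_congr_fun measurableSet_Ioc hinner']
    exact integral_integral_swap (f := fun u s => k (u, s)) hint

theorem rpow_mul_one_sub_rpow_add_integral {a S : ℝ} (ha : 0 < a) (hS0 : 0 < S) (hS1 : S < 1) :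
    S ^ a * (1 - S) ^ a + a * ∫ s in (0 : ℝ)..S, s ^ a * (1 - s) ^ (a - 1) =
      a * ∫ s in (0 : ℝ)..S, s ^ (a - 1) * (1 - s) ^ a := by
  have hi1 := (intervalIntegrable_rpow_mul_one_sub_rpow (a := a) (by linarith) (a - 1)
    hS0 hS1).const_mul a
  have hi2 := (intervalIntegrable_rpow_mul_one_sub_rpow (a := a - 1) (by linarith) a
    hS0 hS1).const_mul a
  have h := intervalIntegral.integral_eq_sub_of_hasDerivAt_of_le hS0.le
    (f := fun s : ℝ => s ^ a * (1 - s) ^ a)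
    ((continuousOn_id.rpow_const fun _ _ => Or.inr ha.le).mul
      ((continuousOn_const.sub continuousOn_id).rpow_const fun _ _ => Or.inr ha.le))
    (fun s hs => ?_) (hi2.sub hi1)
  · rw [intervalIntegral.integral_sub hi2 hi1, intervalIntegral.integral_const_mul,
      intervalIntegral.integral_const_mul, zero_rpow ha.ne', zero_mul, sub_zero] at h
    linarith
  · have h1s : 0 < 1 - s := by linarith [hs.2]
    have hsub : HasDerivAt (fun t : ℝ => 1 - t) (-1) s := by
      simpa using (hasDerivAt_id s).const_sub 1
    refine ((hasDerivAt_rpow_const (p := a) (Or.inl hs.1.ne')).mul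
      (hsub.rpow_const (p := a) (Or.inl h1s.ne'))).congr_deriv ?_
    ring

theorem integral_hyp2F1_one {p S : ℝ} (hp : 1 / 2 < p) (hS0 : 0 < S) (hS1 : S < 1) :
    ∫ u in (0 : ℝ)..S, u ^ (p - 1) * (1 - u) ^ (p - 1) *
        (((S - u) / (1 - u)) ^ (-1 / 2 : ℝ) * (1 - (S - u) / (1 - u)) ^ (p + 1 / 2) *
          hyp2F1 1 p (1 / 2) ((S - u) / (1 - u))) =
      √π * Gamma p / Gamma (p - 1 / 2) * incBeta S (p - 1 / 2) (p + 1 / 2) := by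
  have hp0 : 0 < p := by linarith
  obtain ⟨hint, heq⟩ := integral_rpow_mul_integral_sub_rpow hp0 (b := 1 / 2) (by norm_num) hS0
    (g := fun s => (1 - s) ^ (p - 3 / 2)) (by fun_prop)
    ((continuousOn_const.sub continuousOn_id).rpow_const fun s hs =>
      Or.inl (sub_pos.2 (hs.2.trans_lt hS1)).ne')
    (fun s hs => rpow_nonneg (sub_nonneg.2 (hs.2.trans hS1.le)) _)
  have hpt : ∀ u ∈ Ioo 0 S, u ^ (p - 1) * (1 - u) ^ (p - 1) *
        (((S - u) / (1 - u)) ^ (-1 / 2 : ℝ) * (1 - (S - u) / (1 - u)) ^ (p + 1 / 2) *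
          hyp2F1 1 p (1 / 2) ((S - u) / (1 - u))) =
      (1 - S) ^ (p - 1 / 2) * (u ^ (p - 1) * (S - u) ^ (1 / 2 - 1 : ℝ)) +
        (p - 1 / 2) * (u ^ (p - 1) *
          ∫ s in u..S, (s - u) ^ (1 / 2 - 1 : ℝ) * (1 - s) ^ (p - 3 / 2)) := by
    intro u hu
    have h1u : 0 < 1 - u := by linarith [hu.2]
    have hSu : 0 < S - u := sub_pos.2 hu.2
    have h1S : 0 < 1 - S := sub_pos.2 hS1
    have e : 1 - (S - u) / (1 - u) = (1 - S) / (1 - u) := by field_simp; ring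
    rw [hyp2F1_one_eq_integral hp0 (div_pos hSu h1u) ((div_lt_one h1u).2 (by linarith)), e,
      integral_rpow_comp_affine _ hu.2.le hS1, div_rpow hSu.le h1u.le, div_rpow h1S.le h1u.le,
      show (1 / 2 - 1 : ℝ) = -1 / 2 by norm_num,
      show -(-1 / 2) - (p - 3 / 2) - 1 = -(p - 1) by ring, rpow_neg h1u.le,
      show p - 1 = -1 / 2 + (p - 1 / 2) by ring, rpow_add h1u]
    field_simp
  have hbeta : (p - 1 / 2) * ProbabilityTheory.beta p (1 / 2) =
      √π * Gamma p / Gamma (p - 1 / 2) := by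
    have hG : 0 < Gamma (p - 1 / 2) := Gamma_pos_of_pos (by linarith)
    have ha : p - 1 / 2 ≠ 0 := by linarith
    rw [ProbabilityTheory.beta, show p + 1 / 2 = p - 1 / 2 + 1 by ring, Gamma_add_one ha,
      Gamma_one_half_eq, mul_div_assoc', mul_div_mul_left _ _ ha, mul_comm]
  have hparts := rpow_mul_one_sub_rpow_add_integral (a := p - 1 / 2) (by linarith) hS0 hS1
  rw [intervalIntegral.integral_congr_Ioo_of_le hS0.le hpt,
    intervalIntegral.integral_add
      ((intervalIntegrable_rpow_mul_sub_rpow hp0 (by norm_num) hS0).const_mul _)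
      (hint.const_mul _),
    intervalIntegral.integral_const_mul, intervalIntegral.integral_const_mul, heq,
    integral_rpow_mul_sub_rpow hp0 (by norm_num) hS0, ← hbeta, incBeta,
    show p + 1 / 2 - 1 = p - 1 / 2 by ring, show p - 3 / 2 = p - 1 / 2 - 1 by ring]
  linear_combination ProbabilityTheory.beta p (1 / 2) * hparts

/-- For an integer `d ≥ 3` and `0 < α < π`,
`∫₀^α ((1+cos α)/(1+cos η))^{(d−1)/2} ((1+cos α)/(cos η − cos α))^{1/2}
   ₂F₁(1,(d−1)/2;1/2;(cos η − cos α)/(1+cos η)) sin^{d−2} η dη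
  = (√π 2^{d−2} Γ((d−1)/2)/Γ(d/2−1)) B(sin²(α/2); (d−2)/2, d/2)`. -/
theorem equilibrium_mass_integral_north (d : ℕ) (hd : 3 ≤ d) (α : ℝ)
    (h0 : 0 < α) (h1 : α < π) :
    (∫ η in (0:ℝ)..α,
        ((1 + Real.cos α)/(1 + Real.cos η)) ^ (((d:ℝ) - 1)/2)
        * ((1 + Real.cos α)/(Real.cos η - Real.cos α)) ^ ((1:ℝ)/2)
        * hyp2F1 1 (((d:ℝ) - 1)/2) (1/2) ((Real.cos η - Real.cos α)/(1 + Real.cos η))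
        * Real.sin η ^ ((d:ℝ) - 2))
      = Real.sqrt π * 2 ^ ((d:ℝ) - 2) * Real.Gamma (((d:ℝ) - 1)/2)
          / Real.Gamma ((d:ℝ)/2 - 1)
        * incBeta (Real.sin (α/2) ^ 2) (((d:ℝ) - 2)/2) ((d:ℝ)/2) := by
  set p : ℝ := ((d : ℝ) - 1) / 2 with hp
  have hd' : (3 : ℝ) ≤ d := by exact_mod_cast hd
  have hp1 : 1 / 2 < p := by rw [hp]; linarith
  set S := sin (α / 2) ^ 2 with hS
  have hhalf : ∀ x : ℝ, cos x = 1 - 2 * sin (x / 2) ^ 2 := fun x => by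
    have h := cos_two_mul (x / 2)
    rw [mul_div_cancel₀ x two_ne_zero] at h
    linarith [sin_sq_add_cos_sq (x / 2)]
  have hsin : 0 < sin (α / 2) := sin_pos_of_pos_of_lt_pi (by linarith) (by linarith)
  have hcos : 0 < cos (α / 2) := cos_pos_of_mem_Ioo ⟨by linarith, by linarith⟩
  have hS0 : 0 < S := by positivity
  have hS1 : S < 1 := by nlinarith [sin_sq_add_cos_sq (α / 2)]
  have hsubst := intervalIntegral.integral_comp_mul_deriv_of_deriv_nonneg (a := 0) (b := α)
    (f := fun η => sin (η / 2) ^ 2) (f' := fun η => sin (η / 2) * cos (η / 2))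
    (g := fun u => 2 ^ ((d : ℝ) - 2) * (u ^ (p - 1) * (1 - u) ^ (p - 1) *
        (((S - u) / (1 - u)) ^ (-1 / 2 : ℝ) * (1 - (S - u) / (1 - u)) ^ (p + 1 / 2) *
          hyp2F1 1 p (1 / 2) ((S - u) / (1 - u)))))
    (by fun_prop)
    (fun η _ => by
      refine (((hasDerivAt_id η).div_const 2).sin.pow 2).congr_deriv ?_
      simp only [id]; push_cast; ring)
    (fun η hη => by
      rw [min_eq_left h0.le, max_eq_right h0.le] at hη
      exact mul_nonneg (sin_nonneg_of_nonneg_of_le_pi (by linarith [hη.1]) (by linarith [hη.2]))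
        (cos_nonneg_of_mem_Icc ⟨by linarith [hη.1], by linarith [hη.2]⟩))
  rw [zero_div, sin_zero, zero_pow two_ne_zero, ← hS, intervalIntegral.integral_const_mul,
    integral_hyp2F1_one hp1 hS0 hS1] at hsubst
  rw [show (d : ℝ) / 2 - 1 = p - 1 / 2 by rw [hp]; ring,
    show ((d : ℝ) - 2) / 2 = p - 1 / 2 by rw [hp]; ring,
    show (d : ℝ) / 2 = p + 1 / 2 by rw [hp]; ring]
  refine Eq.trans (intervalIntegral.integral_congr_Ioo_of_le h0.le fun η hη => ?_)
    (hsubst.trans (by ring))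
  have hs : 0 < sin (η / 2) :=
    sin_pos_of_pos_of_lt_pi (by linarith [hη.1]) (by linarith [hη.2])
  have hc : 0 < cos (η / 2) := cos_pos_of_mem_Ioo ⟨by linarith [hη.1], by linarith [hη.2]⟩
  have hsS : sin (η / 2) ^ 2 < S :=
    pow_lt_pow_left₀ (sin_lt_sin_of_lt_of_le_pi_div_two (by linarith [hη.1, pi_pos]) (by linarith)
      (by linarith [hη.2])) hs.le two_ne_zero
  have hc2 : 1 - sin (η / 2) ^ 2 = cos (η / 2) ^ 2 := by rw [cos_sq']
  have hsinη : sin η = 2 * sin (η / 2) * cos (η / 2) := by rw [← sin_two_mul]; ring_nf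
  have h2p : ∀ x : ℝ, 0 < x → x ^ ((d : ℝ) - 2) = (x ^ 2) ^ (p - 1) * x := fun x hx => by
    rw [← rpow_natCast, ← rpow_mul hx.le, ← rpow_add_one hx.ne', hp]; congr 1; push_cast; ring
  have h1S : 0 < 1 - S := sub_pos.2 hS1
  have hSu : 0 < S - sin (η / 2) ^ 2 := sub_pos.2 hsS
  have e1 : (1 + cos α) / (1 + cos η) = (1 - S) / cos (η / 2) ^ 2 := by
    rw [hhalf α, hhalf η, ← hc2]
    have : 1 - sin (η / 2) ^ 2 ≠ 0 := by rw [hc2]; positivity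
    rw [← mul_div_mul_left (1 - S) _ two_ne_zero]; congr 1 <;> ring
  have e2 : (1 + cos α) / (cos η - cos α) = (1 - S) / (S - sin (η / 2) ^ 2) := by
    rw [hhalf α, hhalf η, ← mul_div_mul_left (1 - S) _ two_ne_zero]; congr 1 <;> ring
  have e3 : (cos η - cos α) / (1 + cos η) = (S - sin (η / 2) ^ 2) / cos (η / 2) ^ 2 := by
    rw [hhalf α, hhalf η, ← hc2, ← mul_div_mul_left (S - sin (η / 2) ^ 2) _ two_ne_zero]
    congr 1 <;> ring
  have e4 : 1 - (S - sin (η / 2) ^ 2) / cos (η / 2) ^ 2 = (1 - S) / cos (η / 2) ^ 2 := by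
    rw [← hc2]
    have : 1 - sin (η / 2) ^ 2 ≠ 0 := by rw [hc2]; positivity
    field_simp; ring
  simp only [Function.comp_apply]
  rw [e1, e2, e3, hc2, e4, hsinη, mul_rpow (by positivity) hc.le, mul_rpow zero_le_two hs.le,
    h2p _ hs, h2p _ hc, div_rpow h1S.le hSu.le, div_rpow hSu.le (by positivity),
    rpow_add (div_pos h1S (by positivity)), div_rpow h1S.le (by positivity) (1 / 2),
    show (-1 / 2 : ℝ) = -(1 / 2) by norm_num, rpow_neg hSu.le, rpow_neg (by positivity)]
  field_simp
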